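/- arXiv:2302.05277 — 9 statements merged into one kernel-verified Lean document; each statement's English description precedes it below -/
import Mathlib

section
/- Let f(w_1,…,w_L) = Σ_{l,k=1}^L c_{lk} g(w_l^T Σ_{lk} w_k) be the RGCCA objective. For every index l and every fixed choice of the vectors w_k ∈ ℝ^{p_k} for k ≠ l, the map w_l ↦ f(w_1,…,w_L) is convex on ℝ^{p_l}. -/
open Matrix

/-- A finite sum of convex functions is convex. -/
theorem ConvexOn.finset_sum {ι E : Type*} [AddCommGroup E] [Module ℝ E] {s : Set E}
    {t : Finset ι} {f : ι → E → ℝ} (hs : Convex ℝ s) (hf : ∀ i ∈ t, ConvexOn ℝ s (f i)) :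
    ConvexOn ℝ s (fun x => ∑ i ∈ t, f i x) := by
  refine ⟨hs, fun x hx y hy a b ha hb hab => ?_⟩
  simp only [Finset.smul_sum, ← Finset.sum_add_distrib]
  exact Finset.sum_le_sum fun i hi => (hf i hi).2 hx hy ha hb hab

/-- The quadratic form of a real positive semidefinite matrix is convex. -/
theorem Matrix.PosSemidef.convexOn_dotProduct_mulVec {n : Type*} [Fintype n]
    {A : Matrix n n ℝ} (hA : A.PosSemidef) :
    ConvexOn ℝ Set.univ (fun v : n → ℝ => v ⬝ᵥ (A *ᵥ v)) := by
  refine ⟨convex_univ, fun x _ y _ a b ha hb hab => ?_⟩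
  have h : 0 ≤ (x - y) ⬝ᵥ (A *ᵥ (x - y)) := by
    simpa using hA.dotProduct_mulVec_nonneg (x - y)
  have hmul := mul_nonneg (mul_nonneg ha hb) h
  obtain rfl : b = 1 - a := by linarith
  simp only [mulVec_add, mulVec_sub, mulVec_smul, add_dotProduct, sub_dotProduct,
    dotProduct_add, dotProduct_sub, smul_dotProduct, dotProduct_smul, smul_eq_mul] at hmul ⊢
  linarith

/-- Post-composing a nonnegative convex function with a convex function that is monotone on
`[0, ∞)` gives a convex function. -/
theorem ConvexOn.comp_nonneg_of_monotoneOn {E : Type*} [AddCommGroup E] [Module ℝ E] {s : Set E}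
    {g : ℝ → ℝ} {q : E → ℝ} (hg : ConvexOn ℝ Set.univ g) (hmono : MonotoneOn g (Set.Ici 0))
    (hq : ConvexOn ℝ s q) (hq_nonneg : ∀ x ∈ s, 0 ≤ q x) :
    ConvexOn ℝ s (fun x => g (q x)) := by
  refine ⟨hq.1, fun x hx y hy a b ha hb hab => ?_⟩
  have hle := hq.2 hx hy ha hb hab
  have hnonneg := hq_nonneg _ (hq.1 hx hy ha hb hab)
  exact (hmono hnonneg (hnonneg.trans hle) hle).trans
    (hg.2 (Set.mem_univ _) (Set.mem_univ _) ha hb hab)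

/-- Multi-convexity of the RGCCA objective: for every block index `l` and fixed
vectors `w k` (`k ≠ l`), the map `v ↦ f(w₁,…,w_{l-1},v,w_{l+1},…,w_L)` is convex. -/
theorem rgcca_objective_multiconvex {L : ℕ} (p : Fin L → ℕ)
    (c : Fin L → Fin L → ℝ)
    (hc_nonneg : ∀ l k, 0 ≤ c l k) (hc_symm : ∀ l k, c l k = c k l)
    (S : ∀ l k, Matrix (Fin (p l)) (Fin (p k)) ℝ)
    (hS_symm : ∀ l k, S k l = (S l k)ᵀ)
    (hS_psd : ∀ l, (S l l).PosSemidef)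
    (g : ℝ → ℝ) (hg_conv : ConvexOn ℝ Set.univ g)
    (hg_diff : Differentiable ℝ g)
    (hg' : ∀ x : ℝ, 0 ≤ x → 0 ≤ deriv g x)
    (w : ∀ k, Fin (p k) → ℝ) (l : Fin L) :
    ConvexOn ℝ Set.univ (fun v : Fin (p l) → ℝ =>
      ∑ i, ∑ k, c i k *
        g (Function.update w l v i ⬝ᵥ (S i k *ᵥ Function.update w l v k))) := by
  have hmono : MonotoneOn g (Set.Ici 0) :=
    monotoneOn_of_deriv_nonneg (convex_Ici 0) hg_diff.continuous.continuousOn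
      hg_diff.differentiableOn fun x hx => hg' x (interior_subset hx)
  refine ConvexOn.finset_sum convex_univ fun i _ =>
    ConvexOn.finset_sum convex_univ fun k _ => ?_
  refine ConvexOn.smul (hc_nonneg i k) ?_
  by_cases hi : i = l
  · subst hi
    by_cases hk : k = i
    · subst hk
      simp only [Function.update_self]
      exact hg_conv.comp_nonneg_of_monotoneOn hmono (hS_psd k).convexOn_dotProduct_mulVec
        fun v _ => by simpa using (hS_psd k).dotProduct_mulVec_nonneg v
    · simp only [Function.update_self, Function.update_of_ne hk]
      exact hg_conv.comp_linearMap ((dotProductBilin ℝ ℝ).flip (S i k *ᵥ w k))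
  · simp only [Function.update_of_ne hi]
    by_cases hk : k = l
    · subst hk
      simp only [Function.update_self]
      exact hg_conv.comp_linearMap (dotProductBilin ℝ ℝ (w i) ∘ₗ (S i k).mulVecLin)
    · simp only [Function.update_of_ne hk]
      exact convexOn_const _ convex_univ
end

section
/- Let Ω be a nonempty compact subset of ℝ^N, f : ℝ^N → ℝ continuous, c : Ω → Ω a continuous map satisfying f(c(w)) ≥ f(w) for all w ∈ Ω, with f(c(w)) = f(w) only when c(w) = w, and let w^{s+1} = c(w^s) with w^0 ∈ Ω. Then the limit of any convergent subsequence of {w^s}_{s≥0} is a fixed point of c. -/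
open Filter

/-- The limit of any convergent subsequence of the iterates `wˢ` is a fixed
point of `c`. -/
theorem ascent_iterates_subseq_limit_is_fixed_point {N : ℕ}
    (Ω : Set (EuclideanSpace ℝ (Fin N))) (hΩne : Ω.Nonempty) (hΩc : IsCompact Ω)
    (f : EuclideanSpace ℝ (Fin N) → ℝ) (hf : Continuous f)
    (c : EuclideanSpace ℝ (Fin N) → EuclideanSpace ℝ (Fin N))
    (hc : Set.MapsTo c Ω Ω) (hcont : ContinuousOn c Ω)
    (hinc : ∀ x ∈ Ω, f x ≤ f (c x))
    (hfix : ∀ x ∈ Ω, f (c x) = f x → c x = x)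
    (w : ℕ → EuclideanSpace ℝ (Fin N))
    (hw0 : w 0 ∈ Ω) (hrec : ∀ s, w (s + 1) = c (w s)) :
    ∀ (φ : ℕ → ℕ), StrictMono φ →
      ∀ x : EuclideanSpace ℝ (Fin N),
        Tendsto (fun s => w (φ s)) atTop (nhds x) → x ∈ Ω ∧ c x = x := by
  intro φ hφ x hx
  have hwΩ : ∀ s, w s ∈ Ω := by
    intro s
    induction s with
    | zero => exact hw0
    | succ s ih => exact hrec s ▸ hc ih
  have hxΩ : x ∈ Ω := hΩc.isClosed.mem_of_tendsto hx (Eventually.of_forall fun s => hwΩ (φ s))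
  refine ⟨hxΩ, hfix x hxΩ ?_⟩
  have hmono : Monotone fun s => f (w s) :=
    monotone_nat_of_le_succ fun s => hrec s ▸ hinc (w s) (hwΩ s)
  have hlim : Tendsto (fun s => f (w s)) atTop (nhds (f x)) :=
    (tendsto_iff_tendsto_subseq_of_monotone hmono hφ.tendsto_atTop).2
      ((hf.tendsto x).comp hx)
  have hcw : Tendsto (fun s => c (w (φ s))) atTop (nhds (c x)) :=
    (hcont x hxΩ).tendsto.comp
      (tendsto_nhdsWithin_iff.2 ⟨hx, Eventually.of_forall fun s => hwΩ (φ s)⟩)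
  have hsucc : Tendsto (fun s => f (c (w (φ s)))) atTop (nhds (f x)) := by
    simpa only [Function.comp_def, hrec] using
      hlim.comp ((tendsto_add_atTop_nat 1).comp hφ.tendsto_atTop)
  exact tendsto_nhds_unique ((hf.tendsto (c x)).comp hcw) hsucc
end

section
/- Let Ω be a nonempty compact subset of ℝ^N, f : ℝ^N → ℝ continuous, c : Ω → Ω a continuous map satisfying f(c(w)) ≥ f(w) for all w ∈ Ω, with f(c(w)) = f(w) only when c(w) = w, and let w^{s+1} = c(w^s) with w^0 ∈ Ω. Then there exists a fixed point w* of c such that lim_{s→∞} f(w^s) = f(w*). -/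
open Filter

/-- The values `f(wˢ)` converge to `f(w*)` for some fixed point `w*` of `c`. -/
theorem ascent_iterates_values_tendsto_value_at_fixed_point {N : ℕ}
    (Ω : Set (EuclideanSpace ℝ (Fin N))) (hΩne : Ω.Nonempty) (hΩc : IsCompact Ω)
    (f : EuclideanSpace ℝ (Fin N) → ℝ) (hf : Continuous f)
    (c : EuclideanSpace ℝ (Fin N) → EuclideanSpace ℝ (Fin N))
    (hc : Set.MapsTo c Ω Ω) (hcont : ContinuousOn c Ω)
    (hinc : ∀ x ∈ Ω, f x ≤ f (c x))
    (hfix : ∀ x ∈ Ω, f (c x) = f x → c x = x)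
    (w : ℕ → EuclideanSpace ℝ (Fin N))
    (hw0 : w 0 ∈ Ω) (hrec : ∀ s, w (s + 1) = c (w s)) :
    ∃ wstar ∈ Ω, c wstar = wstar ∧
      Tendsto (fun s => f (w s)) atTop (nhds (f wstar)) := by
  have hw : ∀ s, w s ∈ Ω := by
    intro s
    induction s with
    | zero => exact hw0
    | succ s ih => exact hrec s ▸ hc ih
  have hmono : Monotone fun s => f (w s) :=
    monotone_nat_of_le_succ fun s => hrec s ▸ hinc _ (hw s)
  obtain ⟨a, ha, φ, hφ, hlim⟩ := hΩc.tendsto_subseq hw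
  have hfw : Tendsto (fun s => f (w s)) atTop (nhds (f a)) :=
    (tendsto_iff_tendsto_subseq_of_monotone hmono hφ.tendsto_atTop).2
      ((hf.tendsto a).comp hlim)
  have hclim : Tendsto (fun n => c (w (φ n))) atTop (nhds (c a)) :=
    (hcont a ha).tendsto.comp
      (tendsto_nhdsWithin_iff.2 ⟨hlim, Eventually.of_forall fun n => hw (φ n)⟩)
  have hfc : Tendsto (fun n => f (c (w (φ n)))) atTop (nhds (f a)) := by
    simpa only [Function.comp_def, hrec] using
      hfw.comp ((tendsto_add_atTop_nat 1).comp hφ.tendsto_atTop)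
  exact ⟨a, ha, hfix a ha (tendsto_nhds_unique ((hf.tendsto _).comp hclim) hfc), hfw⟩
end

section
/- Let Ω be a nonempty compact subset of ℝ^N, f : ℝ^N → ℝ continuous, c : Ω → Ω a continuous map satisfying f(c(w)) ≥ f(w) for all w ∈ Ω, with f(c(w)) = f(w) only when c(w) = w, and let w^{s+1} = c(w^s) with w^0 ∈ Ω. Then the sequence {w^s}_{s≥0} is asymptotically regular: lim_{s→∞} ‖w^{s+1} − w^s‖ = 0. -/
open Filter

/-- The iterates `wˢ` are asymptotically regular: `‖w^{s+1} − wˢ‖ → 0`. -/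
theorem ascent_iterates_asymptotically_regular {N : ℕ}
    (Ω : Set (EuclideanSpace ℝ (Fin N))) (hΩne : Ω.Nonempty) (hΩc : IsCompact Ω)
    (f : EuclideanSpace ℝ (Fin N) → ℝ) (hf : Continuous f)
    (c : EuclideanSpace ℝ (Fin N) → EuclideanSpace ℝ (Fin N))
    (hc : Set.MapsTo c Ω Ω) (hcont : ContinuousOn c Ω)
    (hinc : ∀ x ∈ Ω, f x ≤ f (c x))
    (hfix : ∀ x ∈ Ω, f (c x) = f x → c x = x)
    (w : ℕ → EuclideanSpace ℝ (Fin N))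
    (hw0 : w 0 ∈ Ω) (hrec : ∀ s, w (s + 1) = c (w s)) :
    Tendsto (fun s => ‖w (s + 1) - w s‖) atTop (nhds 0) := by
  have hw : ∀ s, w s ∈ Ω := by
    intro s
    induction s with
    | zero => exact hw0
    | succ s ih => rw [hrec]; exact hc ih
  have hmono : Monotone fun s => f (w s) :=
    monotone_nat_of_le_succ fun s => by rw [hrec]; exact hinc _ (hw s)
  have hbdd : BddAbove (Set.range fun s => f (w s)) :=
    (hΩc.bddAbove_image hf.continuousOn).mono <| by
      rintro _ ⟨s, rfl⟩
      exact Set.mem_image_of_mem f (hw s)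
  have hlim := tendsto_atTop_ciSup hmono hbdd
  refine tendsto_of_subseq_tendsto fun ns hns => ?_
  obtain ⟨a, ha, φ, hφ, hφa⟩ := hΩc.tendsto_subseq fun k => hw (ns k)
  have hsub : Tendsto (fun k => ns (φ k)) atTop atTop := hns.comp hφ.tendsto_atTop
  have hwa : Tendsto (fun k => w (ns (φ k))) atTop (nhds a) := hφa
  have hca : Tendsto (fun k => w (ns (φ k) + 1)) atTop (nhds (c a)) := by
    simp only [hrec]
    exact (hcont a ha).tendsto.comp
      (tendsto_nhdsWithin_iff.2 ⟨hwa, Eventually.of_forall fun k => hw _⟩)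
  have hfa := tendsto_nhds_unique ((hf.tendsto a).comp hwa) (hlim.comp hsub)
  have hfca := tendsto_nhds_unique ((hf.tendsto (c a)).comp hca)
    (hlim.comp ((tendsto_add_atTop_nat 1).comp hsub))
  have hfixed : c a = a := hfix a ha (hfca.trans hfa.symm)
  refine ⟨φ, ?_⟩
  simpa [hfixed] using (hca.sub hwa).norm
end

section
/- Let Ω be a nonempty compact subset of ℝ^N, f : ℝ^N → ℝ continuous, c : Ω → Ω a continuous map satisfying f(c(w)) ≥ f(w) for all w ∈ Ω, with f(c(w)) = f(w) only when c(w) = w, and let w^{s+1} = c(w^s) with w^0 ∈ Ω. If the set of fixed points {w ∈ Ω : c(w) = w} is finite, then the sequence {w^s}_{s≥0} converges to one of them. -/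
open Filter

open scoped Topology

/-- Every cluster point in `Ω` of an orbit staying in the compact set `Ω` is a fixed point, when a
continuous function strictly increases along the orbit away from fixed points. -/
theorem IsCompact.map_eq_of_mapClusterPt_orbit {X : Type*} [TopologicalSpace X]
    {Ω : Set X} (hΩ : IsCompact Ω) {f : X → ℝ} (hf : ContinuousOn f Ω)
    {c : X → X} (hc : Set.MapsTo c Ω Ω) (hcont : ContinuousOn c Ω)
    (hinc : ∀ x ∈ Ω, f x ≤ f (c x)) (hfix : ∀ x ∈ Ω, f (c x) = f x → c x = x)
    {w : ℕ → X} (hw : ∀ s, w s ∈ Ω) (hrec : ∀ s, w (s + 1) = c (w s))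
    {x : X} (hx : x ∈ Ω) (hxw : MapClusterPt x atTop w) : c x = x := by
  have hmono : Monotone fun s => f (w s) :=
    monotone_nat_of_le_succ fun s => by simpa only [hrec] using hinc _ (hw s)
  have hbdd : BddAbove (Set.range fun s => f (w s)) :=
    (hΩ.bddAbove_image hf).mono <| Set.range_subset_iff.2 fun s => Set.mem_image_of_mem f (hw s)
  have hlim := tendsto_atTop_ciSup hmono hbdd
  obtain ⟨u, hu, hux⟩ := mapClusterPt_iff_ultrafilter.1 hxw
  have hwx : Tendsto w u (𝓝[Ω] x) :=
    tendsto_nhdsWithin_iff.2 ⟨hux, Eventually.of_forall hw⟩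
  have hcx : Tendsto (fun s => c (w s)) u (𝓝[Ω] (c x)) :=
    tendsto_nhdsWithin_iff.2 ⟨(hcont x hx).tendsto.comp hwx, Eventually.of_forall fun s => hc (hw s)⟩
  have hfx := tendsto_nhds_unique ((hf x hx).tendsto.comp hwx) (hlim.mono_left hu)
  have hlim' := (hlim.comp (tendsto_add_atTop_nat 1)).mono_left hu
  simp only [Function.comp_def, hrec] at hlim'
  have hfcx := tendsto_nhds_unique ((hf (c x) (hc hx)).tendsto.comp hcx) hlim'
  exact hfix x hx (hfcx.trans hfx.symm)

/-- An orbit in a compact set whose cluster points all lie in a finite set of fixed points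
converges to one of them. -/
theorem IsCompact.exists_tendsto_orbit_of_finite {X : Type*} [TopologicalSpace X] [T2Space X]
    {Ω F : Set X} (hΩ : IsCompact Ω) (hF : F.Finite) {c : X → X} (hcont : ContinuousOn c Ω)
    (hFΩ : ∀ x ∈ F, x ∈ Ω ∧ c x = x)
    {w : ℕ → X} (hw : ∀ s, w s ∈ Ω) (hrec : ∀ s, w (s + 1) = c (w s))
    (hclus : ∀ x ∈ Ω, MapClusterPt x atTop w → x ∈ F) :
    ∃ x ∈ F, Tendsto w atTop (𝓝 x) := by
  obtain ⟨x, hxΩ, hxw⟩ := hΩ.exists_mapClusterPt_of_frequently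
    (Frequently.of_forall hw : ∃ᶠ s in atTop, w s ∈ Ω)
  have hxF := hclus x hxΩ hxw
  refine ⟨x, hxF, ?_⟩
  obtain ⟨U, V, hU, hV, hxU, hFV, hUV⟩ := SeparatedNhds.of_isCompact_isCompact
    (isCompact_singleton (x := x)) (hF.subset Set.sdiff_subset : (F \ {x}).Finite).isCompact
    Set.disjoint_sdiff_right
  rw [Set.singleton_subset_iff] at hxU
  have hcU : ∀ᶠ y in 𝓝[Ω] x, c y ∈ U :=
    (hcont x hxΩ).tendsto.eventually (by rw [(hFΩ x hxF).2]; exact hU.mem_nhds hxU)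
  obtain ⟨W, hWsub, hW, hxW⟩ := eventually_nhds_iff.1 (eventually_nhdsWithin_iff.1 hcU)
  have hWV : ∀ᶠ s in atTop, w s ∈ W ∪ V := by
    refine (hΩ.tendsto_nhdsSet_of_mapClusterPt (Eventually.of_forall hw) hclus)
      ((hW.union hV).mem_nhdsSet.2 fun y hy => ?_)
    by_cases hyx : y = x
    · exact Or.inl (hyx ▸ hxW)
    · exact Or.inr (hFV ⟨hy, hyx⟩)
  obtain ⟨n, hn⟩ := eventually_atTop.1 hWV
  obtain ⟨m, hnm, hm⟩ := frequently_atTop.1 (hxw.frequently (hW.mem_nhds hxW)) n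
  have hstay : ∀ s ≥ m, w s ∈ W := by
    intro s hs
    induction s, hs using Nat.le_induction with
    | base => exact hm
    | succ s hs ih =>
      have hsU : w (s + 1) ∈ U := hrec s ▸ hWsub _ ih (hw s)
      exact (hn (s + 1) (by lia)).resolve_right (Set.disjoint_left.1 hUV hsU)
  have hstayU : ∀ᶠ s in atTop, w s ∉ V := by
    filter_upwards [eventually_gt_atTop m] with s hs
    obtain ⟨t, rfl⟩ := Nat.exists_eq_add_one_of_ne_zero (Nat.ne_zero_of_lt hs)
    exact Set.disjoint_left.1 hUV (hrec t ▸ hWsub _ (hstay t (by lia)) (hw t))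
  refine hΩ.tendsto_nhds_of_unique_mapClusterPt (Eventually.of_forall hw) fun y hy hyw => ?_
  by_contra hyx
  exact hyw.frequently (hV.mem_nhds (hFV ⟨hclus y hy hyw, hyx⟩)) hstayU

/-- If `c` has finitely many fixed points in `Ω`, the iterates `wˢ` converge to
one of them. -/
theorem ascent_iterates_converge_to_fixed_point_of_finitely_many {N : ℕ}
    (Ω : Set (EuclideanSpace ℝ (Fin N))) (hΩne : Ω.Nonempty) (hΩc : IsCompact Ω)
    (f : EuclideanSpace ℝ (Fin N) → ℝ) (hf : Continuous f)
    (c : EuclideanSpace ℝ (Fin N) → EuclideanSpace ℝ (Fin N))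
    (hc : Set.MapsTo c Ω Ω) (hcont : ContinuousOn c Ω)
    (hinc : ∀ x ∈ Ω, f x ≤ f (c x))
    (hfix : ∀ x ∈ Ω, f (c x) = f x → c x = x)
    (w : ℕ → EuclideanSpace ℝ (Fin N))
    (hw0 : w 0 ∈ Ω) (hrec : ∀ s, w (s + 1) = c (w s))
    (hfin : {x ∈ Ω | c x = x}.Finite) :
    ∃ x ∈ Ω, c x = x ∧ Tendsto w atTop (nhds x) := by
  have hw : ∀ s, w s ∈ Ω := fun s => by
    induction s with
    | zero => exact hw0
    | succ s ih => exact hrec s ▸ hc ih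
  obtain ⟨x, hx, hlim⟩ := hΩc.exists_tendsto_orbit_of_finite hfin hcont (fun _ hx => hx) hw hrec
    fun x hx hxw =>
      ⟨hx, hΩc.map_eq_of_mapClusterPt_orbit hf.continuousOn hc hcont hinc hfix hw hrec hx hxw⟩
  exact ⟨x, hx.1, hx.2, hlim⟩
end

section
/- Let F ∈ ℝ^{p×R} with p ≥ R and rank(F) = R. Then the maximizer of V ↦ trace(F^T V) over matrices V ∈ ℝ^{p×R} with orthonormal columns (V^T V = I_R) is unique: there is exactly one such V at which the maximum value is attained. -/
open Matrix

namespace Matrix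

theorem isUnit_of_rank_eq_card {n K : Type*} [Fintype n] [DecidableEq n] [Field K]
    {A : Matrix n n K} (hA : A.rank = Fintype.card n) : IsUnit A := by
  rw [← mulVec_surjective_iff_isUnit]
  have h : LinearMap.range A.mulVecLin = ⊤ :=
    Submodule.eq_top_of_finrank_eq (by rw [Module.finrank_fintype_fun_eq_card]; exact hA)
  exact LinearMap.range_eq_top.mp h

open scoped MatrixOrder in
theorem PosDef.exists_sq_transpose_mul_self {n : Type*} [Fintype n] [DecidableEq n]
    {A : Matrix n n ℝ} (hA : A.PosDef) :
    ∃ C : Matrix n n ℝ, IsUnit C ∧ (Cᵀ * C) * (Cᵀ * C) = A := by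
  have hA0 : 0 ≤ A := hA.posSemidef.nonneg
  have hS0 : 0 ≤ CFC.sqrt A := CFC.sqrt_nonneg A
  have hC : (CFC.sqrt (CFC.sqrt A))ᵀ = CFC.sqrt (CFC.sqrt A) := by
    rw [← conjTranspose_eq_transpose_of_trivial]
    exact (CFC.sqrt_nonneg (CFC.sqrt A)).posSemidef.isHermitian
  refine ⟨CFC.sqrt (CFC.sqrt A), ?_, ?_⟩
  · rw [CFC.isUnit_sqrt_iff _ hS0, CFC.isUnit_sqrt_iff _ hA0]
    exact hA.isUnit
  · rw [hC, CFC.sqrt_mul_sqrt_self _ hS0, CFC.sqrt_mul_sqrt_self _ hA0]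

/-- A polar decomposition `F = V * (Cᵀ * C)` of a matrix of full column rank. -/
theorem exists_polar_of_rank_eq_card {m n : Type*} [Fintype m] [Fintype n] [DecidableEq n]
    {F : Matrix m n ℝ} (hF : F.rank = Fintype.card n) :
    ∃ (V : Matrix m n ℝ) (C : Matrix n n ℝ), IsUnit C ∧ Vᵀ * V = 1 ∧ F = V * (Cᵀ * C) := by
  have hpos : (Fᵀ * F).PosDef := by
    have h : (Fᵀ * F).PosSemidef := by
      simpa only [conjTranspose_eq_transpose_of_trivial] using posSemidef_conjTranspose_mul_self F
    exact h.posDef_iff_isUnit.mpr (isUnit_of_rank_eq_card (by rwa [rank_transpose_mul_self]))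
  obtain ⟨C, hC, hCF⟩ := hpos.exists_sq_transpose_mul_self
  have hS : IsUnit (Cᵀ * C).det :=
    (isUnit_iff_isUnit_det _).mp (((isUnit_transpose C).mpr hC).mul hC)
  have hST : (Cᵀ * C)ᵀ = Cᵀ * C := by rw [transpose_mul, transpose_transpose]
  refine ⟨F * (Cᵀ * C)⁻¹, C, hC, ?_, (nonsing_inv_mul_cancel_right _ F hS).symm⟩
  rw [transpose_mul, transpose_nonsing_inv, hST, Matrix.mul_assoc, ← Matrix.mul_assoc Fᵀ, ← hCF,
    mul_nonsing_inv_cancel_right _ _ hS, nonsing_inv_mul _ hS]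

/-- The trace gap between a polar factor and another matrix with orthonormal columns. -/
theorem trace_conj_sub_eq_of_orthonormal {m n : Type*} [Fintype m] [Fintype n] [DecidableEq n]
    {V U : Matrix m n ℝ} (hV : Vᵀ * V = 1) (hU : Uᵀ * U = 1) (C : Matrix n n ℝ) :
    (((V - U) * Cᵀ) * ((V - U) * Cᵀ)ᵀ).trace =
      2 * (((V * (Cᵀ * C))ᵀ * V).trace - ((V * (Cᵀ * C))ᵀ * U).trace) := by
  have hUV : (Cᵀ * C * (Uᵀ * V)).trace = (Cᵀ * C * (Vᵀ * U)).trace := by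
    rw [← trace_transpose, trace_mul_comm (Cᵀ * C) (Vᵀ * U)]
    simp only [transpose_mul, transpose_transpose]
  have h : (((V - U) * Cᵀ) * ((V - U) * Cᵀ)ᵀ).trace =
      (Cᵀ * C * ((V - U)ᵀ * (V - U))).trace := by
    rw [transpose_mul, transpose_transpose, Matrix.mul_assoc, trace_mul_comm]
    simp only [Matrix.mul_assoc]
  have hF (W : Matrix m n ℝ) : (V * (Cᵀ * C))ᵀ * W = Cᵀ * C * (Vᵀ * W) := by
    simp only [transpose_mul, transpose_transpose, Matrix.mul_assoc]
  rw [h, hF, hF, transpose_sub, Matrix.sub_mul, Matrix.mul_sub Vᵀ, Matrix.mul_sub Uᵀ, hV, hU]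
  simp only [Matrix.mul_sub, trace_sub, hUV]
  ring

end Matrix

/-- If `F ∈ ℝ^{p×R}` with `p ≥ R` has full rank `R`, then the maximizer of
`V ↦ trace(FᵀV)` over matrices with orthonormal columns is unique. -/
theorem trace_maximizer_unique_of_full_rank {p R : ℕ} (hpR : R ≤ p)
    (F : Matrix (Fin p) (Fin R) ℝ) (hrank : F.rank = R) :
    ∃! V : Matrix (Fin p) (Fin R) ℝ,
      Vᵀ * V = 1 ∧
        ∀ U : Matrix (Fin p) (Fin R) ℝ, Uᵀ * U = 1 →
          (Fᵀ * U).trace ≤ (Fᵀ * V).trace := by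
  obtain ⟨V, C, hC, hV, rfl⟩ := exists_polar_of_rank_eq_card (F := F) (by simpa using hrank)
  have gap {U : Matrix (Fin p) (Fin R) ℝ} (hU : Uᵀ * U = 1) :=
    trace_conj_sub_eq_of_orthonormal hV hU C
  refine ⟨V, ⟨hV, fun U hU => ?_⟩, fun U ⟨hU, hmax⟩ => ?_⟩
  · have h := (posSemidef_self_mul_conjTranspose ((V - U) * Cᵀ)).trace_nonneg
    rw [conjTranspose_eq_transpose_of_trivial, gap hU] at h
    linarith
  · have h := (posSemidef_self_mul_conjTranspose ((V - U) * Cᵀ)).trace_nonneg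
    have h0 : (((V - U) * Cᵀ) * ((V - U) * Cᵀ)ᴴ).trace = 0 := by
      rw [conjTranspose_eq_transpose_of_trivial, gap hU] at h ⊢
      linarith [hmax V hV]
    rw [trace_mul_conjTranspose_self_eq_zero_iff] at h0
    have hCT : IsUnit (Cᵀ).det :=
      (isUnit_iff_isUnit_det _).mp ((isUnit_transpose C).mpr hC)
    have hsub : V - U = 0 := by
      rw [← mul_nonsing_inv_cancel_right _ (V - U) hCT, h0, Matrix.zero_mul]
    exact (sub_eq_zero.mp hsub).symm
end

section
/- For any d ≥ 1 and dimensions p_1,…,p_d, the set of vectors in ℝ^{p_1 p_2 ⋯ p_d} that can be written as an iterated Kronecker product w_d ⊗ w_{d−1} ⊗ ⋯ ⊗ w_1 of vectors w_m ∈ ℝ^{p_m} is a closed subset of ℝ^{p_1 p_2 ⋯ p_d}. -/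
/-- A function on a finite product is a product of functions of one coordinate each if and only if
exchanging a single coordinate of two multi-indices does not change the product of its values. -/
theorem exists_eq_prod_iff_forall_mul_eq_update_mul_update {ι K : Type*} [Fintype ι]
    [DecidableEq ι] [Nonempty ι] [Field K] {κ : ι → Type*} (v : ((m : ι) → κ m) → K) :
    (∃ w : (m : ι) → κ m → K, v = fun i => ∏ m, w m (i m)) ↔
      ∀ i j m, v i * v j = v (Function.update i m (j m)) * v (Function.update j m (i m)) := by
  constructor
  · rintro ⟨w, rfl⟩ i j m
    simp only [← Finset.prod_mul_distrib]
    refine Finset.prod_congr rfl fun n _ => ?_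
    rcases eq_or_ne n m with rfl | h
    · simp [mul_comm]
    · simp [h]
  · intro h
    obtain ⟨m₀⟩ := ‹Nonempty ι›
    by_cases hv : ∀ a, v a = 0
    · refine ⟨fun _ _ => 0, funext fun i => ?_⟩
      rw [hv, Finset.prod_eq_zero (Finset.mem_univ m₀) rfl]
    · push Not at hv
      obtain ⟨a, ha⟩ := hv
      have key (i : (m : ι) → κ m) (s : Finset ι) :
          v (s.piecewise i a) = v a * ∏ m ∈ s, (v (Function.update a m (i m)) / v a) := by
        induction s using Finset.induction_on with
        | empty => simp
        | insert m s hm ih =>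
          have hx := h ((insert m s).piecewise i a) a m
          rw [Finset.piecewise_insert, Function.update_idem, Function.update_self,
            Function.update_eq_self_iff.2 (Finset.piecewise_eq_of_notMem s i a hm).symm, ih] at hx
          rw [Finset.piecewise_insert, Finset.prod_insert hm, eq_div_of_mul_eq ha hx]
          ring
      refine ⟨fun m k => (if m = m₀ then v a else 1) * (v (Function.update a m k) / v a),
        funext fun i => ?_⟩
      rw [Finset.prod_mul_distrib, Finset.prod_ite_eq' Finset.univ m₀ fun _ => v a,
        if_pos (Finset.mem_univ m₀), ← key, Finset.piecewise_univ]

/-- The set of rank-one tensors — vectors of `ℝ^{p₁⋯p_d}` that are iterated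
Kronecker products `w_d ⊗ ⋯ ⊗ w_1` (identified with the functions on the
multi-index set `Π m, Fin (p m)` given by `i ↦ Π m, w_m (i m)`) — is closed. -/
theorem isClosed_setOf_kronecker_products {d : ℕ} (hd : 1 ≤ d) (p : Fin d → ℕ) :
    IsClosed {v : ((m : Fin d) → Fin (p m)) → ℝ |
      ∃ w : (m : Fin d) → Fin (p m) → ℝ, v = fun i => ∏ m, w m (i m)} := by
  have : Nonempty (Fin d) := ⟨⟨0, hd⟩⟩
  simp only [exists_eq_prod_iff_forall_mul_eq_update_mul_update, Set.ofPred_forall]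
  refine isClosed_iInter fun i => isClosed_iInter fun j => isClosed_iInter fun m => ?_
  exact isClosed_eq (by fun_prop) (by fun_prop)
end

section
/- Fix d ≥ 1, dimensions p_1,…,p_d with p = p_1 ⋯ p_d, an integer R ≥ 1 and a real α ≥ 0. The set Ω of vectors w ∈ ℝ^p such that there exist λ ∈ ℝ^R with λ^T λ ≤ α and vectors w_m^{(r)} ∈ ℝ^{p_m} (m = 1,…,d, r = 1,…,R) with w^{(r)} = w_d^{(r)} ⊗ ⋯ ⊗ w_1^{(r)}, the matrix W = [w^{(1)} … w^{(R)}] ∈ ℝ^{p×R} satisfying W^T W = I_R, and w = Wλ = Σ_{r=1}^R λ_r w^{(r)}, is a compact subset of ℝ^p. The same conclusion holds when the constraint λ^T λ ≤ α is replaced by λ^T λ = α. -/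
open Matrix

lemma isCompact_setOf_dotProduct_self_le {ι : Type*} [Fintype ι] (a : ℝ) :
    IsCompact {v : ι → ℝ | v ⬝ᵥ v ≤ a} := by
  refine (isCompact_univ_pi fun _ : ι => isCompact_Icc (a := -√a) (b := √a)).of_isClosed_subset
    (isClosed_le (by fun_prop) continuous_const) fun v hv i _ => ?_
  have h : v i * v i ≤ v ⬝ᵥ v :=
    Finset.single_le_sum (f := fun j => v j * v j) (fun j _ => mul_self_nonneg (v j))
      (Finset.mem_univ i)
  have h' : v i ^ 2 ≤ a := by
    rw [sq]
    exact h.trans hv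
  exact abs_le.mp (Real.abs_le_sqrt h')

lemma isCompact_setOf_dotProduct_self_eq {ι : Type*} [Fintype ι] (a : ℝ) :
    IsCompact {v : ι → ℝ | v ⬝ᵥ v = a} :=
  (isCompact_setOf_dotProduct_self_le a).of_isClosed_subset
    (isClosed_eq (by fun_prop) continuous_const) fun _ hv => le_of_eq hv

section RankOne

variable {μ : Type*} [Fintype μ] [DecidableEq μ] {κ : μ → Type*} [∀ m, Fintype (κ m)]

lemma dotProduct_self_prod (v : (m : μ) → κ m → ℝ) :
    (fun i : (m : μ) → κ m => ∏ m, v m (i m)) ⬝ᵥ (fun i => ∏ m, v m (i m)) =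
      ∏ m, v m ⬝ᵥ v m := by
  simp only [dotProduct, ← Finset.prod_mul_distrib, Finset.prod_univ_sum, Fintype.piFinset_univ]

/-- The factors of a unit rank-one tensor can be normalized. -/
lemma exists_unit_factors {t : ((m : μ) → κ m) → ℝ} {v : (m : μ) → κ m → ℝ}
    (ht : ∀ i, t i = ∏ m, v m (i m)) (h1 : t ⬝ᵥ t = 1) :
    ∃ u : (m : μ) → κ m → ℝ, (∀ m, u m ⬝ᵥ u m = 1) ∧ ∀ i, t i = ∏ m, u m (i m) := by
  have hprod : ∏ m, v m ⬝ᵥ v m = 1 := by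
    rw [← dotProduct_self_prod, ← h1, ← funext ht]
  have hnonneg (m : μ) : 0 ≤ v m ⬝ᵥ v m := Finset.sum_nonneg fun _ _ => mul_self_nonneg _
  have hne (m : μ) : v m ⬝ᵥ v m ≠ 0 :=
    Finset.prod_ne_zero_iff.mp (hprod ▸ one_ne_zero) m (Finset.mem_univ m)
  have hsqrt : ∏ m, √(v m ⬝ᵥ v m) = 1 := by
    rw [← Real.sqrt_prod _ fun m _ => hnonneg m, hprod, Real.sqrt_one]
  refine ⟨fun m => (√(v m ⬝ᵥ v m))⁻¹ • v m, fun m => ?_, fun i => ?_⟩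
  · rw [smul_dotProduct, dotProduct_smul, smul_eq_mul, smul_eq_mul, ← mul_assoc, ← mul_inv,
      Real.mul_self_sqrt (hnonneg m), inv_mul_cancel₀ (hne m)]
  · simp only [Pi.smul_apply, smul_eq_mul, Finset.prod_mul_distrib, Finset.prod_inv_distrib,
      hsqrt, inv_one, one_mul, ht]

lemma isCompact_unit_rankOne :
    IsCompact {t : ((m : μ) → κ m) → ℝ |
      (∃ v : (m : μ) → κ m → ℝ, ∀ i, t i = ∏ m, v m (i m)) ∧ t ⬝ᵥ t = 1} := by
  have hK := isCompact_univ_pi fun m : μ => isCompact_setOf_dotProduct_self_eq (ι := κ m) 1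
  have hcont : Continuous fun (v : (m : μ) → κ m → ℝ) (i : (m : μ) → κ m) => ∏ m, v m (i m) := by
    fun_prop
  convert hK.image hcont using 1
  ext t
  constructor
  · rintro ⟨⟨v, hv⟩, h1⟩
    obtain ⟨u, hu, htu⟩ := exists_unit_factors hv h1
    exact ⟨u, fun m _ => hu m, (funext htu).symm⟩
  · rintro ⟨u, hu, rfl⟩
    refine ⟨⟨u, fun _ => rfl⟩, ?_⟩
    rw [dotProduct_self_prod]
    exact Finset.prod_eq_one fun m _ => hu m (Set.mem_univ m)

lemma isCompact_orthonormal_rankOne {ρ : Type*} [Fintype ρ] [DecidableEq ρ] :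
    IsCompact {W : Matrix ((m : μ) → κ m) ρ ℝ |
      (∀ r, ∃ v : (m : μ) → κ m → ℝ, ∀ i, W i r = ∏ m, v m (i m)) ∧ Wᵀ * W = 1} := by
  have hK := (isCompact_univ_pi fun _ : ρ => isCompact_unit_rankOne (κ := κ)).image
    (Continuous.matrix_transpose continuous_id : Continuous fun A : Matrix ρ _ ℝ => Aᵀ)
  have hclosed : IsClosed {W : Matrix ((m : μ) → κ m) ρ ℝ | Wᵀ * W = 1} :=
    isClosed_eq (by fun_prop) continuous_const
  convert hK.inter_right hclosed using 1
  ext W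
  constructor
  · rintro ⟨hW, h1⟩
    refine ⟨⟨Wᵀ, fun r _ => ⟨hW r, ?_⟩, transpose_transpose W⟩, h1⟩
    simpa [mul_apply, dotProduct] using congrFun (congrFun h1 r) r
  · rintro ⟨⟨A, hA, rfl⟩, h1⟩
    exact ⟨fun r => (hA r (Set.mem_univ r)).1, h1⟩

lemma isCompact_orthonormal_rankOne_mulVec {ρ : Type*} [Fintype ρ] [DecidableEq ρ]
    {S : Set (ρ → ℝ)} (hS : IsCompact S) :
    IsCompact {w : ((m : μ) → κ m) → ℝ |
      ∃ (lam : ρ → ℝ) (W : Matrix ((m : μ) → κ m) ρ ℝ), lam ∈ S ∧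
        (∀ r, ∃ v : (m : μ) → κ m → ℝ, ∀ i, W i r = ∏ m, v m (i m)) ∧
        Wᵀ * W = 1 ∧ w = W *ᵥ lam} := by
  have hcont : Continuous fun x : (ρ → ℝ) × Matrix ((m : μ) → κ m) ρ ℝ => x.2 *ᵥ x.1 := by
    fun_prop
  convert (hS.prod (isCompact_orthonormal_rankOne (κ := κ))).image hcont using 1
  ext w
  constructor
  · rintro ⟨lam, W, hlam, hW, h1, rfl⟩
    exact ⟨(lam, W), ⟨hlam, hW, h1⟩, rfl⟩
  · rintro ⟨⟨lam, W⟩, ⟨hlam, hW, h1⟩, rfl⟩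
    exact ⟨lam, W, hlam, hW, h1, rfl⟩

end RankOne

/-- The feasible set `Ω` of TGCCA — vectors `w = Wλ` where the columns of `W`
are orthonormal rank-one tensors (iterated Kronecker products, identified with
functions on the multi-index set `Π m, Fin (p m)`) and `λᵀλ ≤ α` — is compact;
the same holds with the constraint `λᵀλ = α`. -/
theorem isCompact_tgcca_feasible_set {d : ℕ} (hd : 1 ≤ d) (p : Fin d → ℕ)
    {R : ℕ} (hR : 1 ≤ R) (α : ℝ) (hα : 0 ≤ α) :
    IsCompact {w : ((m : Fin d) → Fin (p m)) → ℝ |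
        ∃ (lam : Fin R → ℝ) (W : Matrix ((m : Fin d) → Fin (p m)) (Fin R) ℝ),
          lam ⬝ᵥ lam ≤ α ∧
          (∀ r, ∃ wm : (m : Fin d) → Fin (p m) → ℝ, ∀ i, W i r = ∏ m, wm m (i m)) ∧
          Wᵀ * W = 1 ∧ w = W *ᵥ lam} ∧
      IsCompact {w : ((m : Fin d) → Fin (p m)) → ℝ |
        ∃ (lam : Fin R → ℝ) (W : Matrix ((m : Fin d) → Fin (p m)) (Fin R) ℝ),
          lam ⬝ᵥ lam = α ∧
          (∀ r, ∃ wm : (m : Fin d) → Fin (p m) → ℝ, ∀ i, W i r = ∏ m, wm m (i m)) ∧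
          Wᵀ * W = 1 ∧ w = W *ᵥ lam} :=
  ⟨isCompact_orthonormal_rankOne_mulVec (isCompact_setOf_dotProduct_self_le α),
    isCompact_orthonormal_rankOne_mulVec (isCompact_setOf_dotProduct_self_eq α)⟩
end

section
/- Let u ∈ ℝ^R be nonzero, α > 0, ε ∈ ℝ with ε² < α ‖u‖₂², and λ_ref ∈ ℝ^R, and let P = I_R − u u^T / ‖u‖₂² be the orthogonal projector onto the hyperplane orthogonal to u. Assume P λ_ref ≠ 0 and set λ̂ = (ε/‖u‖₂²) u + √(α − ε²/‖u‖₂²) · P λ_ref / ‖P λ_ref‖₂. Then λ̂ satisfies λ̂^T λ̂ = α and u^T λ̂ = ε, and λ̂ minimizes ‖λ − λ_ref‖₂ over all λ ∈ ℝ^R satisfying λ^T λ = α and u^T λ = ε. -/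
section InnerProductSpace

open scoped RealInnerProductSpace

variable {E : Type*} [NormedAddCommGroup E] [InnerProductSpace ℝ E]

/-- Among vectors of equal norm, the one with the larger inner product with `x` is closer to `x`. -/
lemma norm_sub_le_norm_sub_of_inner_le {x y z : E} (hyz : ‖y‖ ^ 2 = ‖z‖ ^ 2)
    (h : ⟪z, x⟫ ≤ ⟪y, x⟫) : ‖y - x‖ ≤ ‖z - x‖ := by
  rw [← sq_le_sq₀ (norm_nonneg _) (norm_nonneg _), norm_sub_sq_real, norm_sub_sq_real]
  linarith

lemma inner_sub_smul_self_eq_zero {u : E} (hu : u ≠ 0) (x : E) :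
    ⟪u, x - (⟪u, x⟫ / ‖u‖ ^ 2) • u⟫ = 0 := by
  have : ‖u‖ ≠ 0 := norm_ne_zero_iff.2 hu
  rw [inner_sub_right, real_inner_smul_right, real_inner_self_eq_norm_sq]
  field_simp
  ring

/-- The squared norm of the component orthogonal to `u` of a vector `z` with `⟪u, z⟫ = ε`. -/
lemma norm_sub_smul_sq_of_inner_eq {u z : E} {ε : ℝ} (hu : u ≠ 0) (hz : ⟪u, z⟫ = ε) :
    ‖z - (ε / ‖u‖ ^ 2) • u‖ ^ 2 = ‖z‖ ^ 2 - ε ^ 2 / ‖u‖ ^ 2 := by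
  have : ‖u‖ ≠ 0 := norm_ne_zero_iff.2 hu
  rw [norm_sub_sq_real, real_inner_smul_right, real_inner_comm, hz, norm_smul, mul_pow,
    Real.norm_eq_abs, sq_abs]
  field_simp
  ring

lemma inner_smul_add_smul_of_inner_eq_zero {u p : E} (hu : u ≠ 0) (hup : ⟪u, p⟫ = 0)
    (ε s : ℝ) : ⟪u, (ε / ‖u‖ ^ 2) • u + s • ‖p‖⁻¹ • p⟫ = ε := by
  have : ‖u‖ ≠ 0 := norm_ne_zero_iff.2 hu
  simp only [inner_add_right, real_inner_smul_right, hup, real_inner_self_eq_norm_sq]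
  field_simp
  ring

lemma norm_sq_smul_add_sqrt_smul {u p : E} {α ε : ℝ} (hu : u ≠ 0) (hp : p ≠ 0)
    (hup : ⟪u, p⟫ = 0) (hε : ε ^ 2 ≤ α * ‖u‖ ^ 2) :
    ‖(ε / ‖u‖ ^ 2) • u + √(α - ε ^ 2 / ‖u‖ ^ 2) • ‖p‖⁻¹ • p‖ ^ 2 = α := by
  have hp' : ‖p‖ ≠ 0 := norm_ne_zero_iff.2 hp
  have hu' : 0 < ‖u‖ ^ 2 := pow_pos (norm_pos_iff.2 hu) 2
  have h := norm_sub_smul_sq_of_inner_eq hu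
    (inner_smul_add_smul_of_inner_eq_zero hu hup ε √(α - ε ^ 2 / ‖u‖ ^ 2))
  rw [add_sub_cancel_left, norm_smul, norm_smul, norm_inv, norm_norm, inv_mul_cancel₀ hp',
    mul_one, Real.norm_eq_abs, sq_abs,
    Real.sq_sqrt (sub_nonneg.2 ((div_le_iff₀ hu').2 hε))] at h
  linarith

lemma inner_le_inner_smul_add_sqrt_smul {u x z p : E} {α ε : ℝ} (hu : u ≠ 0)
    (hpx : p = x - (⟪u, x⟫ / ‖u‖ ^ 2) • u) (hp : p ≠ 0)
    (hz : ‖z‖ ^ 2 = α) (huz : ⟪u, z⟫ = ε) :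
    ⟪z, x⟫ ≤ ⟪(ε / ‖u‖ ^ 2) • u + √(α - ε ^ 2 / ‖u‖ ^ 2) • ‖p‖⁻¹ • p, x⟫ := by
  have hup : ⟪u, p⟫ = 0 := hpx ▸ inner_sub_smul_self_eq_zero hu x
  have hp' : ‖p‖ ≠ 0 := norm_ne_zero_iff.2 hp
  have hx : x = p + (⟪u, x⟫ / ‖u‖ ^ 2) • u := by rw [hpx, sub_add_cancel]
  have hy := inner_smul_add_smul_of_inner_eq_zero hu hup ε √(α - ε ^ 2 / ‖u‖ ^ 2)
  have hzp : ⟪z, p⟫ ≤ √(α - ε ^ 2 / ‖u‖ ^ 2) * ‖p‖ := by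
    have h := real_inner_le_norm (z - (ε / ‖u‖ ^ 2) • u) p
    rwa [inner_sub_left, real_inner_smul_left, hup, mul_zero, sub_zero,
      ← Real.sqrt_sq (norm_nonneg (z - _)), norm_sub_smul_sq_of_inner_eq hu huz, hz] at h
  have hyp : ⟪(ε / ‖u‖ ^ 2) • u + √(α - ε ^ 2 / ‖u‖ ^ 2) • ‖p‖⁻¹ • p, p⟫ =
      √(α - ε ^ 2 / ‖u‖ ^ 2) * ‖p‖ := by
    simp only [inner_add_left, real_inner_smul_left, hup, real_inner_self_eq_norm_sq]
    field_simp
    ring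
  rw [hx, inner_add_right, inner_add_right, real_inner_smul_right, real_inner_smul_right,
    real_inner_comm u z, huz, hyp, real_inner_comm u (_ + _), hy]
  exact add_le_add_left hzp _

end InnerProductSpace

lemma EuclideanSpace.dotProduct_eq_inner {ι : Type*} [Fintype ι] (x y : EuclideanSpace ℝ ι) :
    x ⬝ᵥ y = inner ℝ x y := by
  rw [EuclideanSpace.inner_eq_star_dotProduct, star_trivial, dotProduct_comm]


open Matrix

/-- Projection onto the intersection of the sphere `{λ : λᵀλ = α}` and the
hyperplane `{λ : uᵀλ = ε}`: the point `λ̂ = (ε/‖u‖²)u + √(α − ε²/‖u‖²)·Pλ_ref/‖Pλ_ref‖`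
is feasible and minimizes the distance to `λ_ref`. -/
theorem projection_sphere_hyperplane {R : ℕ}
    (u : EuclideanSpace ℝ (Fin R)) (hu : u ≠ 0)
    (α : ℝ) (hα : 0 < α) (ε : ℝ) (hε : ε ^ 2 < α * ‖u‖ ^ 2)
    (lref : EuclideanSpace ℝ (Fin R))
    (P : Matrix (Fin R) (Fin R) ℝ)
    (hP : P = 1 - (‖u‖ ^ 2)⁻¹ • Matrix.vecMulVec u u)
    (Pl : EuclideanSpace ℝ (Fin R)) (hPldef : Pl = P *ᵥ lref) (hPl : Pl ≠ 0)
    (lhat : EuclideanSpace ℝ (Fin R))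
    (hlhat : lhat = (ε / ‖u‖ ^ 2) • u +
      Real.sqrt (α - ε ^ 2 / ‖u‖ ^ 2) • ‖Pl‖⁻¹ • Pl) :
    lhat ⬝ᵥ lhat = α ∧ u ⬝ᵥ lhat = ε ∧
      ∀ lam : EuclideanSpace ℝ (Fin R), lam ⬝ᵥ lam = α → u ⬝ᵥ lam = ε →
        ‖lhat - lref‖ ≤ ‖lam - lref‖ := by
  have hPlx : Pl = lref - (inner ℝ u lref / ‖u‖ ^ 2) • u := by
    ext i
    rw [hPldef, hP, sub_mulVec, one_mulVec, smul_mulVec, vecMulVec_mulVec,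
      EuclideanSpace.dotProduct_eq_inner]
    simp
    ring
  have hup : inner ℝ u Pl = 0 := hPlx ▸ inner_sub_smul_self_eq_zero hu lref
  have hnorm : ‖lhat‖ ^ 2 = α := hlhat ▸ norm_sq_smul_add_sqrt_smul hu hPl hup hε.le
  simp only [EuclideanSpace.dotProduct_eq_inner, real_inner_self_eq_norm_sq]
  refine ⟨hnorm, hlhat ▸ inner_smul_add_smul_of_inner_eq_zero hu hup ε _, fun lam hlam hulam ↦ ?_⟩
  refine norm_sub_le_norm_sub_of_inner_le (hnorm.trans hlam.symm) ?_
  rw [hlhat]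
  exact inner_le_inner_smul_add_sqrt_smul hu hPlx hPl hlam hulam
end
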